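/- arXiv:math/0610260 — 5 statements merged into one kernel-verified Lean document; each statement's English description precedes it below -/
import Mathlib

section
/- Let A be a finite category. The following three conditions are equivalent: (1) every idempotent endomorphism in A is an identity; (2) every endomorphism in A is an automorphism (i.e. an isomorphism); (3) every circuit in A consists entirely of isomorphisms, i.e. for every n ≥ 1 and every composable sequence of morphisms a_0 → a_1 → ⋯ → a_n with a_n = a_0, each morphism in the sequence is an isomorphism. -/
open CategoryTheory

/-- **Lemma 1.3** (Leinster, "The Euler characteristic of a category").
For a finite category `A`, the following are equivalent:
(1) every idempotent is an identity;
(2) every endomorphism is an automorphism (isomorphism);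
(3) every circuit consists entirely of isomorphisms. -/
theorem stmt_0 {A : Type u} [Category.{v} A] [Fintype A]
    [∀ a b : A, Fintype (a ⟶ b)] :
    List.TFAE
      [ ∀ (a : A) (f : a ⟶ a), f ≫ f = f → f = 𝟙 a,
        ∀ (a : A) (f : a ⟶ a), IsIso f,
        ∀ (n : ℕ), 1 ≤ n → ∀ (o : Fin (n + 1) → A)
          (f : ∀ i : Fin n, o i.castSucc ⟶ o i.succ),
          o (Fin.last n) = o 0 → ∀ i : Fin n, IsIso (f i) ] := by
  tfae_have 1 → 2 := by
    intro h a f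
    let x : End a := f
    obtain ⟨p, q, hpq, he⟩ : ∃ p q : ℕ, p < q ∧ x ^ p = x ^ q := by
      haveI : Finite (End a) := inferInstanceAs (Finite (a ⟶ a))
      obtain ⟨p, q, hne, he⟩ := Finite.exists_ne_map_eq_of_infinite (fun n : ℕ => x ^ n)
      rcases lt_or_gt_of_ne hne with h1 | h1
      · exact ⟨p, q, h1, he⟩
      · exact ⟨q, p, h1, he.symm⟩
    obtain ⟨k, rfl⟩ := Nat.exists_eq_add_of_lt hpq
    have step : ∀ l j : ℕ, x ^ (p + j) = x ^ (p + j + (k + 1) * l) := by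
      intro l
      induction l with
      | zero => intro j; simp
      | succ l ih =>
        intro j
        rw [ih j]
        have e1 : p + j + (k + 1) * l = p + (j + (k + 1) * l) := by ring
        have e2 : p + j + (k + 1) * (l + 1) = (p + k + 1) + (j + (k + 1) * l) := by ring
        rw [e1, e2, pow_add, pow_add x (p + k + 1), he]
    -- the power with exponent (k+1)(p+1) is idempotent
    have hid : x ^ ((k + 1) * (p + 1)) * x ^ ((k + 1) * (p + 1))
        = x ^ ((k + 1) * (p + 1)) := by
      have e := step (p + 1) (k * (p + 1) + 1)
      have e1 : p + (k * (p + 1) + 1) = (k + 1) * (p + 1) := by ring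
      rw [e1] at e
      rw [← pow_add, ← e]
    have h1 : x ^ ((k + 1) * (p + 1)) = 1 := h a _ hid
    have hu : IsUnit x := IsUnit.of_pow_eq_one h1 (by positivity)
    exact (isUnit_iff_isIso f).1 hu
  tfae_have 2 → 3 := by
    intro h n _ o f hc i
    have hfrom : ∀ j : Fin (n + 1), Nonempty (o 0 ⟶ o j) := by
      intro j
      induction j using Fin.induction with
      | zero => exact ⟨𝟙 _⟩
      | succ j ih => exact ih.map (fun g => g ≫ f j)
    have hto : ∀ j : Fin (n + 1), Nonempty (o j ⟶ o (Fin.last n)) := by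
      intro j
      induction j using Fin.reverseInduction with
      | last => exact ⟨𝟙 _⟩
      | cast j ih => exact ih.map (fun g => f j ≫ g)
    obtain ⟨u⟩ := hto i.succ
    obtain ⟨w⟩ := hfrom i.castSucc
    let g : o i.succ ⟶ o i.castSucc := u ≫ eqToHom hc ≫ w
    haveI h1 : IsIso (f i ≫ g) := h _ _
    haveI h2 : IsIso (g ≫ f i) := h _ _
    haveI : Mono (f i) := mono_of_mono (f i) g
    haveI : IsSplitEpi (f i) := ⟨⟨⟨inv (g ≫ f i) ≫ g, by simp [-IsIso.inv_comp]⟩⟩⟩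
    exact isIso_of_mono_of_isSplitEpi (f i)
  tfae_have 3 → 2 := by
    intro h a f
    exact h 1 le_rfl (fun _ => a) (fun _ => f) rfl 0
  tfae_have 2 → 1 := by
    intro h a f hf
    haveI := h a f
    rw [← cancel_epi f, hf, Category.comp_id]
  tfae_finish
end

section
/- Let A be a finite skeletal category in which the only endomorphisms are identities. Then A has Möbius inversion, and its Möbius function is given by μ(a,b) = ∑_{n ≥ 0} (−1)^n · (number of nondegenerate n-paths from a to b); in particular μ takes integer values. -/
open CategoryTheory

open scoped Classical in
theorem sum_paths_eq_pow {A : Type*} [Fintype A] (N : Matrix A A ℚ) (n : ℕ) : ∀ a b : A,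
    (∑ o : Fin (n + 1) → A, if o 0 = a ∧ o (Fin.last n) = b then
      ∏ i : Fin n, N (o i.castSucc) (o i.succ) else 0) = (N ^ n) a b := by
  induction n with
  | zero =>
    intro a b
    rw [← (Equiv.funUnique (Fin 1) A).symm.sum_comp]
    rw [Finset.sum_eq_single a]
    · simp [Matrix.one_apply]
    · intro c _ hc
      simp [hc]
    · simp
  | succ n ih =>
    intro a b
    rw [pow_succ', Matrix.mul_apply, ← (Fin.consEquiv (fun _ : Fin (n + 2) => A)).sum_comp,
      Fintype.sum_prod_type_right]
    simp_rw [← ih, Finset.mul_sum]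
    conv_rhs => rw [Finset.sum_comm]
    refine Finset.sum_congr rfl fun o _ => ?_
    rw [Finset.sum_eq_single a, Finset.sum_eq_single (o 0)]
    · rw [Fin.prod_univ_succ]
      simp [Fin.consEquiv, ← Fin.succ_last, -Fin.succ_last, ← Fin.succ_castSucc]
    · intro c _ hc
      simp [hc.symm]
    · simp
    · intro c _ hc
      simp [Fin.consEquiv, hc]
    · simp

open scoped Classical in
theorem card_nondeg_hom {A : Type*} [Category A]
    [∀ a b : A, Fintype (a ⟶ b)]
    (endo : ∀ (a : A) (f : a ⟶ a), f = 𝟙 a) (a b : A) :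
    Nat.card {f : a ⟶ b // ∀ h : a = b, f ≠ eqToHom h} =
      if a = b then 0 else Fintype.card (a ⟶ b) := by
  split_ifs with h
  · subst h
    have : IsEmpty {f : a ⟶ a // ∀ h : a = a, f ≠ eqToHom h} :=
      ⟨fun f => f.2 rfl (by simpa using endo a f.1)⟩
    exact Nat.card_of_isEmpty
  · rw [Nat.card_congr (Equiv.subtypeUnivEquiv fun f h' => absurd h' h), Nat.card_eq_fintype_card]

/-- Nondegenerate paths, organised by their vertices. -/
def pathEquiv {A : Type*} [Category A] (n : ℕ) (a b : A) :
    {p : Σ o : Fin (n + 1) → A, ∀ i : Fin n, (o i.castSucc ⟶ o i.succ) //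
              p.1 0 = a ∧ p.1 (Fin.last n) = b ∧
                ∀ (i : Fin n) (h : p.1 i.castSucc = p.1 i.succ),
                  p.2 i ≠ eqToHom h} ≃
    Σ o : {o : Fin (n + 1) → A // o 0 = a ∧ o (Fin.last n) = b},
      ∀ i : Fin n, {f : o.1 i.castSucc ⟶ o.1 i.succ //
        ∀ h : o.1 i.castSucc = o.1 i.succ, f ≠ eqToHom h} where
  toFun p := ⟨⟨p.1.1, p.2.1, p.2.2.1⟩, fun i => ⟨p.1.2 i, p.2.2.2 i⟩⟩
  invFun q := ⟨⟨q.1.1, fun i => (q.2 i).1⟩, q.1.2.1, q.1.2.2, fun i => (q.2 i).2⟩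
  left_inv _ := rfl
  right_inv _ := rfl

open scoped Classical in
theorem card_paths {A : Type*} [Category A] [Fintype A]
    [∀ a b : A, Fintype (a ⟶ b)]
    (endo : ∀ (a : A) (f : a ⟶ a), f = 𝟙 a) (n : ℕ) (a b : A) :
    (Nat.card {p : Σ o : Fin (n + 1) → A, ∀ i : Fin n, (o i.castSucc ⟶ o i.succ) //
              p.1 0 = a ∧ p.1 (Fin.last n) = b ∧
                ∀ (i : Fin n) (h : p.1 i.castSucc = p.1 i.succ),
                  p.2 i ≠ eqToHom h} : ℚ) =
    ((Matrix.of fun x y : A => if x = y then (0 : ℚ) else (Fintype.card (x ⟶ y) : ℚ)) ^ n) a b := by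
  have : Fintype {o : Fin (n + 1) → A // o 0 = a ∧ o (Fin.last n) = b} := Fintype.ofFinite _
  rw [← sum_paths_eq_pow, Nat.card_congr (pathEquiv n a b), Nat.card_sigma (α := {o : Fin (n + 1) → A // o 0 = a ∧ o (Fin.last n) = b}), ← Finset.sum_filter]
  push_cast
  rw [Finset.sum_subtype (F := this) (p := fun o : Fin (n + 1) → A => o 0 = a ∧ o (Fin.last n) = b)
    (Finset.univ.filter fun o : Fin (n + 1) → A => o 0 = a ∧ o (Fin.last n) = b) (by simp)]
  refine Finset.sum_congr (by ext; simp) fun o _ => ?_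
  rw [Nat.card_pi]
  push_cast
  refine Finset.prod_congr rfl fun i _ => ?_
  rw [card_nondeg_hom endo]
  simp

open scoped Classical in
theorem pow_eq_zero_paths {A : Type*} [Category A] [Fintype A]
    [∀ a b : A, Fintype (a ⟶ b)]
    (skel : CategoryTheory.Skeletal A)
    (endo : ∀ (a : A) (f : a ⟶ a), f = 𝟙 a) :
    (Matrix.of fun x y : A => if x = y then (0 : ℚ) else (Fintype.card (x ⟶ y) : ℚ))
      ^ (Fintype.card A) = 0 := by
  ext a b
  rw [← sum_paths_eq_pow]
  refine Finset.sum_eq_zero fun o _ => ?_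
  split_ifs with hab
  swap
  · rfl
  by_contra hne
  rw [Finset.prod_eq_zero_iff] at hne
  push Not at hne
  let P : PartialOrder A :=
    { le := fun x y => Nonempty (x ⟶ y)
      le_refl := fun x => ⟨𝟙 x⟩
      le_trans := fun x y z ⟨f⟩ ⟨g⟩ => ⟨f ≫ g⟩
      le_antisymm := fun x y ⟨f⟩ ⟨g⟩ => skel ⟨⟨f, g, endo _ _, endo _ _⟩⟩ }
  have hmono : StrictMono o := by
    rw [Fin.strictMono_iff_lt_succ]
    intro i
    have := hne i (Finset.mem_univ i)
    simp only [Matrix.of_apply] at this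
    split_ifs at this with h
    · exact absurd rfl this
    · refine lt_of_le_of_ne ?_ h
      exact Fintype.card_pos_iff.mp (Nat.pos_of_ne_zero (by exact_mod_cast this))
  have := Fintype.card_le_of_injective o hmono.injective
  simp at this

theorem sum_int_cast (s : Finset ℕ) (k : ℕ → ℕ) :
    ∃ m : ℤ, ∑ n ∈ s, (-1 : ℚ) ^ n * (k n : ℚ) = (m : ℚ) :=
  ⟨∑ n ∈ s, (-1 : ℤ) ^ n * (k n : ℤ), by push_cast; rfl⟩

open scoped Classical in
/-- **Corollary 1.5** (Leinster). A finite skeletal category in which the only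
endomorphisms are identities has Möbius inversion, given by
`μ(a,b) = ∑_{n ≥ 0} (-1)^n ⬝ #{nondegenerate n-paths from a to b}`;
in particular `μ` takes integer values. -/
theorem stmt_2 {A : Type u} [Category.{v} A] [Fintype A]
    [∀ a b : A, Fintype (a ⟶ b)]
    (skel : CategoryTheory.Skeletal A)
    (endo : ∀ (a : A) (f : a ⟶ a), f = 𝟙 a)
    (μ : A → A → ℚ)
    (hμ : ∀ a b : A, μ a b =
      ∑' n : ℕ,
        (-1 : ℚ) ^ n *
          (Nat.card
            {p : Σ o : Fin (n + 1) → A, ∀ i : Fin n, (o i.castSucc ⟶ o i.succ) //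
              p.1 0 = a ∧ p.1 (Fin.last n) = b ∧
                ∀ (i : Fin n) (h : p.1 i.castSucc = p.1 i.succ),
                  p.2 i ≠ eqToHom h} : ℚ)) :
    (∀ a c : A,
      ∑ b : A, μ a b * (Fintype.card (b ⟶ c) : ℚ) = if a = c then 1 else 0) ∧
    (∀ a c : A,
      ∑ b : A, (Fintype.card (a ⟶ b) : ℚ) * μ b c = if a = c then 1 else 0) ∧
    (∀ a b : A, ∃ m : ℤ, μ a b = (m : ℚ)) := by
  set N : Matrix A A ℚ :=
    Matrix.of fun x y : A => if x = y then (0 : ℚ) else (Fintype.card (x ⟶ y) : ℚ) with hN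
  have hnil : N ^ (Fintype.card A) = 0 := pow_eq_zero_paths skel endo
  have hM : ∀ a b, μ a b = (∑ n ∈ Finset.range (Fintype.card A), (-N) ^ n) a b := by
    intro a b
    rw [hμ, tsum_eq_sum (s := Finset.range (Fintype.card A))]
    · rw [Matrix.sum_apply]
      refine Finset.sum_congr rfl fun n _ => ?_
      rw [card_paths endo, ← hN, neg_pow N n]
      rcases neg_one_pow_eq_or ℚ n with h | h <;>
        rcases Nat.even_or_odd n with h' | h' <;> simp [h'.neg_one_pow]
    · intro n hn
      rw [Finset.mem_range, not_lt] at hn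
      rw [card_paths endo, ← hN, pow_eq_zero_of_le hn hnil]
      simp
  have hz : ∀ a b : A, (Fintype.card (a ⟶ b) : ℚ) = (1 - (-N)) a b := by
    intro a b
    by_cases h : a = b
    · subst h
      have : Fintype.card (a ⟶ a) = 1 :=
        Fintype.card_eq_one_iff.mpr ⟨𝟙 a, endo a⟩
      simp [hN, this]
    · simp [hN, h]
  have hnil' : (-N) ^ (Fintype.card A) = 0 := by rw [neg_pow, hnil, mul_zero]
  refine ⟨fun a c => ?_, fun a c => ?_, fun a b => ?_⟩
  · simp_rw [hM, hz]
    rw [← Matrix.mul_apply, geom_sum_mul_neg, hnil', sub_zero, Matrix.one_apply]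
  · simp_rw [hM, hz]
    rw [← Matrix.mul_apply, mul_neg_geom_sum, hnil', sub_zero, Matrix.one_apply]
  · rw [hμ, tsum_eq_sum (s := Finset.range (Fintype.card A))]
    · exact sum_int_cast _ _
    · intro n hn
      rw [Finset.mem_range, not_lt] at hn
      rw [card_paths endo, ← hN, pow_eq_zero_of_le hn hnil]
      simp
end

section
/- Let A be a finite skeletal category equipped with an epi-mono factorization system (E, M): E is a class of epimorphisms of A and M is a class of monomorphisms of A, each closed under composition and containing all identities, such that every morphism f of A can be written as f = m ∘ e with e ∈ E and m ∈ M, and this factorization is essentially unique, meaning that the pairs (e', m') ∈ E × M with m' ∘ e' = f are exactly those of the form (i ∘ e, m ∘ i⁻¹) for an isomorphism i. Then A has Möbius inversion, given by μ(a,b) = ∑ (−1)^n / (|Aut(a_0)|⋯|Aut(a_n)|), where the sum is over all n ≥ r ≥ 0 and all n-paths a = a_0 →^{f_1} a_1 → ⋯ →^{f_n} a_n = b such that a_0, …, a_r are pairwise distinct, a_r, …, a_n are pairwise distinct, f_1, …, f_r ∈ M, and f_{r+1}, …, f_n ∈ E. -/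
open CategoryTheory

section Helpers

open Matrix

lemma fin_strict {n : ℕ} (g : Fin (n + 1) → ℕ) (s t : ℕ)
    (H : ∀ i : Fin n, s ≤ i.val → i.val < t → g i.castSucc < g i.succ)
    (i j : Fin (n + 1)) (hi : s ≤ i.val) (hj : j.val ≤ t) (hij : i.val < j.val) :
    g i < g j := by
  induction j using Fin.induction with
  | zero => simp at hij
  | succ k ih =>
    simp only [Fin.val_succ] at hj hij
    have h1 := H k (by omega) (by omega)
    rcases Nat.lt_or_ge i.val k.val with h | h
    · exact (ih (by simp; omega) (by simpa using h)).trans h1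
    · have : i = k.castSucc := Fin.ext (by simp; omega)
      rw [this]; exact h1

open scoped Classical in
/-- path matrices -/
noncomputable def pathMat {A : Type*} [Fintype A] (d : A → ℚ) (K : ℕ → Matrix A A ℚ) :
    ℕ → Matrix A A ℚ
  | 0 => diagonal d
  | n + 1 => pathMat d K n * K n * diagonal d

open scoped Classical in
lemma path_sum {A : Type*} [Fintype A] (d : A → ℚ) (K : ℕ → Matrix A A ℚ) (n : ℕ) (a b : A) :
    (∑ o : Fin (n + 1) → A, if o 0 = a ∧ o (Fin.last n) = b then
      (∏ i, d (o i)) * ∏ i : Fin n, K i (o i.castSucc) (o i.succ) else 0) = pathMat d K n a b := by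
  induction n generalizing b with
  | zero =>
    rw [← (Equiv.funUnique (Fin 1) A).symm.sum_comp]
    simp only [pathMat, diagonal_apply]
    by_cases h : a = b
    · subst h
      simp
    · simp only [h, if_false]
      apply Finset.sum_eq_zero
      intro x _
      rw [if_neg]
      rintro ⟨h1, h2⟩
      exact h (h1.symm.trans h2)
  | succ n ih =>
    rw [← (Fin.snocEquiv (fun _ : Fin (n + 2) => A)).sum_comp, Fintype.sum_prod_type]
    rw [pathMat, mul_diagonal, mul_apply]
    simp only [← ih]
    rw [Finset.sum_eq_single b]
    · simp only [Finset.sum_mul]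
      rw [Finset.sum_comm]
      apply Finset.sum_congr rfl
      intro o _
      rw [Finset.sum_eq_single (o (Fin.last n))]
      · have h0 : (Fin.snocEquiv (fun _ : Fin (n + 2) => A)) (b, o) 0 = o 0 := by
          have := Fin.snoc_castSucc (α := fun _ : Fin (n + 2) => A) b o 0
          simpa [Fin.snocEquiv] using this
        have hl : (Fin.snocEquiv (fun _ : Fin (n + 2) => A)) (b, o) (Fin.last (n + 1)) = b := by
          simp [Fin.snocEquiv]
        have hc : ∀ i : Fin (n + 1),
            (Fin.snocEquiv (fun _ : Fin (n + 2) => A)) (b, o) i.castSucc = o i := by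
          intro i; simp [Fin.snocEquiv]
        rw [h0, hl]
        by_cases h : o 0 = a
        · simp only [h, and_self, if_true]
          generalize (Fin.snocEquiv (fun _ : Fin (n + 2) => A)) (b, o) = S at hl hc
          have e2 : (∏ i : Fin (n + 1), K i (S i.castSucc) (S i.succ)) =
              (∏ i : Fin n, K i (o i.castSucc) (o i.succ)) * K n (o (Fin.last n)) b := by
            rw [Fin.prod_univ_castSucc]
            simp only [hc, hl, Fin.succ_last, Fin.succ_castSucc, Fin.val_castSucc, Fin.val_last]
          rw [e2, Fin.prod_univ_castSucc]
          simp only [hc, hl]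
          ring
        · simp [h]
      · intro c _ hcn
        rw [if_neg (fun h => hcn h.2.symm)]; simp
      · simp
    · intro c _ hcb
      apply Finset.sum_eq_zero
      intro o _
      rw [if_neg]
      rintro ⟨_, h⟩
      apply hcb
      simpa [Fin.snocEquiv] using h
    · simp

open scoped Classical in
lemma pathMat_congr {A : Type*} [Fintype A] (d : A → ℚ) (K K' : ℕ → Matrix A A ℚ) (n : ℕ)
    (h : ∀ i < n, K i = K' i) : pathMat d K n = pathMat d K' n := by
  induction n with
  | zero => rfl
  | succ n ih =>
    simp only [pathMat]
    rw [ih (fun i hi => h i (by omega)), h n (by omega)]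

open scoped Classical in
lemma pathMat_split {A : Type*} [Fintype A] (d : A → ℚ) (P Q : Matrix A A ℚ) (r s : ℕ) :
    pathMat d (fun i => if i < r then P else Q) (r + s) =
      (diagonal d * P) ^ r * diagonal d * (Q * diagonal d) ^ s := by
  induction s with
  | zero =>
    rw [add_zero, pathMat_congr d _ (fun _ => P) r (fun i hi => if_pos hi), pow_zero, mul_one]
    induction r with
    | zero => simp [pathMat]
    | succ r ih => rw [pathMat, ih, pow_succ]; simp only [mul_assoc]
  | succ s ih =>
    rw [← add_assoc, pathMat, ih, if_neg (by omega), pow_succ]; simp only [mul_assoc]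

open scoped Classical in
lemma nilp {A : Type*} [Fintype A] (X : Matrix A A ℚ) (h : A → ℕ) (L : ℕ) (hL : ∀ a, h a < L)
    (hX : ∀ a b, X a b ≠ 0 → h a < h b) (k : ℕ) (hk : L ≤ k) : X ^ k = 0 := by
  have key : ∀ k a b, (X ^ k) a b ≠ 0 → h a + k ≤ h b := by
    intro k
    induction k with
    | zero =>
      intro a b hab
      rw [pow_zero, one_apply] at hab
      have : a = b := by by_contra hne; simp [hne] at hab
      simp [this]
    | succ k ih =>
      intro a b hab
      rw [pow_succ, mul_apply] at hab
      obtain ⟨c, _, hc⟩ := Finset.exists_ne_zero_of_sum_ne_zero hab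
      have h1 := ih a c (left_ne_zero_of_mul hc)
      have h2 := hX c b (right_ne_zero_of_mul hc)
      omega
  ext a b
  by_contra hne
  have := key k a b hne
  have := hL b
  omega

lemma conv_sum {R : Type*} [Ring R] (X D Y : R) (L : ℕ) (hX : ∀ k, L ≤ k → X ^ k = 0)
    (hY : ∀ k, L ≤ k → Y ^ k = 0) :
    ∑ n ∈ Finset.range (2 * L), ∑ r ∈ Finset.range (n + 1), X ^ r * D * Y ^ (n - r) =
      (∑ n ∈ Finset.range (2 * L), X ^ n) * D * ∑ n ∈ Finset.range (2 * L), Y ^ n := by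
  rw [Finset.sum_range_diag_flip (2 * L) (fun r s => X ^ r * D * Y ^ s), Finset.sum_mul,
    Finset.sum_mul]
  apply Finset.sum_congr rfl
  intro m hm
  rw [Finset.mul_sum]
  by_cases h : L ≤ m
  · simp [hX m h]
  · apply Finset.sum_subset
    · intro k hk
      simp only [Finset.mem_range] at *
      omega
    · intro k _ hk
      simp only [Finset.mem_range] at *
      rw [hY k (by omega), mul_zero]

lemma epi_endo_iso {A : Type u} [Category.{v} A] [∀ a b : A, Fintype (a ⟶ b)] {a : A}
    (f : a ⟶ a) [Epi f] : IsIso f := by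
  have hinj : Function.Injective (fun g : a ⟶ a => f ≫ g) := fun g g' h => (cancel_epi f).1 h
  obtain ⟨g, hg⟩ := (Finite.injective_iff_surjective.1 hinj) (𝟙 a)
  have : IsSplitMono f := ⟨⟨⟨g, hg⟩⟩⟩
  exact isIso_of_epi_of_isSplitMono f

lemma mono_endo_iso {A : Type u} [Category.{v} A] [∀ a b : A, Fintype (a ⟶ b)] {a : A}
    (f : a ⟶ a) [Mono f] : IsIso f := by
  have hinj : Function.Injective (fun g : a ⟶ a => g ≫ f) := fun g g' h => (cancel_mono f).1 h
  obtain ⟨g, hg⟩ := (Finite.injective_iff_surjective.1 hinj) (𝟙 a)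
  have : IsSplitEpi f := ⟨⟨⟨g, hg⟩⟩⟩
  exact isIso_of_mono_of_isSplitEpi f

open scoped Classical in
lemma exists_height {A : Type u} [Category.{v} A] [Fintype A]
    (skel : CategoryTheory.Skeletal A) (W : MorphismProperty A)
    (hid : ∀ a : A, W (𝟙 a))
    (hcomp : ∀ ⦃a b c : A⦄ (f : a ⟶ b) (g : b ⟶ c), W f → W g → W (f ≫ g))
    (hiso : ∀ ⦃a : A⦄ (f : a ⟶ a), W f → IsIso f) :
    ∃ h : A → ℕ, (∀ a, h a < Fintype.card A + 1) ∧
      ∀ ⦃a b : A⦄ (f : a ⟶ b), W f → a ≠ b → h a < h b := by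
  refine ⟨fun a => (Finset.univ.filter fun c => ∃ f : c ⟶ a, W f).card, ?_, ?_⟩
  · intro a
    exact Nat.lt_succ_of_le (Finset.card_le_univ _)
  · intro a b f hf hab
    apply Finset.card_lt_card
    rw [Finset.ssubset_iff_of_subset]
    · refine ⟨b, by simpa using ⟨𝟙 b, hid b⟩, ?_⟩
      simp only [Finset.mem_filter, Finset.mem_univ, true_and]
      rintro ⟨g, hg⟩
      have h1 := hiso _ (hcomp _ _ hf hg)
      have h2 := hiso _ (hcomp _ _ hg hf)
      have : IsSplitMono f := ⟨⟨⟨g ≫ inv (f ≫ g), by rw [← Category.assoc]; simp⟩⟩⟩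
      have : IsSplitEpi f := ⟨⟨⟨inv (g ≫ f) ≫ g, by rw [Category.assoc]; simp⟩⟩⟩
      have : IsIso f := isIso_of_epi_of_isSplitMono f
      exact hab (skel ⟨asIso f⟩)
    · intro c hc
      simp only [Finset.mem_filter, Finset.mem_univ, true_and] at *
      obtain ⟨g, hg⟩ := hc
      exact ⟨g ≫ f, hcomp _ _ hg hf⟩

open scoped Classical in
/-- counting matrix -/
noncomputable def cnt {A : Type u} [Category.{v} A] [∀ a b : A, Fintype (a ⟶ b)]
    (W : MorphismProperty A) : Matrix A A ℚ :=
  fun a b => ∑ f : a ⟶ b, if W f then 1 else 0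

open scoped Classical in
/-- off-diagonal counting matrix -/
noncomputable def cntOff {A : Type u} [Category.{v} A] [∀ a b : A, Fintype (a ⟶ b)]
    (W : MorphismProperty A) : Matrix A A ℚ :=
  fun a b => ∑ f : a ⟶ b, if a ≠ b ∧ W f then 1 else 0

/-- automorphism count -/
noncomputable def autN {A : Type u} [Category.{v} A] (a : A) : ℚ := (Nat.card (Aut a) : ℚ)

lemma autN_ne {A : Type u} [Category.{v} A] [∀ a b : A, Fintype (a ⟶ b)] (a : A) :
    autN a ≠ 0 := by
  have : Finite (Aut a) := Finite.of_injective (fun i : Aut a => i.hom) (fun i j h => Iso.ext h)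
  unfold autN
  exact_mod_cast Nat.card_pos.ne'

open scoped Classical in
lemma cnt_split {A : Type u} [Category.{v} A] [Fintype A] [∀ a b : A, Fintype (a ⟶ b)]
    (W : MorphismProperty A)
    (hiso : ∀ ⦃a : A⦄ (f : a ⟶ a), W f ↔ IsIso f) :
    cnt W = diagonal autN + cntOff W := by
  ext a b
  rw [Matrix.add_apply, diagonal_apply]
  by_cases h : a = b
  · subst h
    simp only [cnt, cntOff, ne_eq, not_true, false_and, if_false, if_true, Finset.sum_const_zero,
      add_zero, autN, hiso]
    rw [Finset.sum_boole, ← Fintype.card_subtype, ← Nat.card_eq_fintype_card]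
    congr 1
    refine Nat.card_congr ⟨fun f => @asIso _ _ _ _ f.1 f.2, fun i => ⟨i.hom, Iso.isIso_hom i⟩, ?_, ?_⟩
    · intro f; rfl
    · intro i; ext; rfl
  · simp [cnt, cntOff, h]

open scoped Classical in
lemma zeta_fact {A : Type u} [Category.{v} A] [Fintype A]
    [∀ a b : A, Fintype (a ⟶ b)]
    (skel : CategoryTheory.Skeletal A)
    (E M : MorphismProperty A)
    (hE_epi : ∀ ⦃a b : A⦄ (f : a ⟶ b), E f → Epi f)
    (hfact : ∀ ⦃a b : A⦄ (f : a ⟶ b), ∃ (c : A) (e : a ⟶ c) (m : c ⟶ b),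
      E e ∧ M m ∧ e ≫ m = f ∧
        ∀ (c' : A) (e' : a ⟶ c') (m' : c' ⟶ b),
          (E e' ∧ M m' ∧ e' ≫ m' = f) ↔
            ∃ i : c ≅ c', e' = e ≫ i.hom ∧ m' = i.inv ≫ m) (a b : A) :
    (cnt E * diagonal (fun x : A => (autN x)⁻¹) * cnt M) a b = (Fintype.card (a ⟶ b) : ℚ) := by
  have key : ∀ f : a ⟶ b, ∑ c : A, (∑ p : (a ⟶ c) × (c ⟶ b),
      if E p.1 ∧ M p.2 ∧ p.1 ≫ p.2 = f then (1 : ℚ) else 0) * (autN c)⁻¹ = 1 := by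
    intro f
    obtain ⟨c, e, m, he, hm, hf, H⟩ := hfact f
    rw [Finset.sum_eq_single c]
    · have : (∑ p : (a ⟶ c) × (c ⟶ b),
          if E p.1 ∧ M p.2 ∧ p.1 ≫ p.2 = f then (1 : ℚ) else 0) = autN c := by
        rw [Finset.sum_boole, ← Fintype.card_subtype, ← Nat.card_eq_fintype_card, autN]
        congr 1
        symm
        refine Nat.card_congr (Equiv.ofBijective
          (fun i : Aut c => ⟨(e ≫ i.hom, i.inv ≫ m), (H _ _ _).2 ⟨i, rfl, rfl⟩⟩) ⟨?_, ?_⟩)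
        · intro i j hij
          have := hE_epi e he
          simp only [Subtype.mk.injEq, Prod.mk.injEq] at hij
          exact Iso.ext ((cancel_epi e).1 hij.1)
        · rintro ⟨⟨e', m'⟩, h⟩
          obtain ⟨i, h1, h2⟩ := (H _ _ _).1 h
          exact ⟨i, by simp only at h1 h2; subst h1 h2; rfl⟩
      rw [this, mul_inv_cancel₀ (autN_ne c)]
    · intro c' _ hne
      rw [Finset.sum_eq_zero, zero_mul]
      intro p _
      rw [if_neg]
      intro h
      obtain ⟨i, _⟩ := (H _ _ _).1 h
      exact hne (skel ⟨i⟩).symm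
    · simp
  calc _ = ∑ f : a ⟶ b, ∑ c : A, (∑ p : (a ⟶ c) × (c ⟶ b),
      if E p.1 ∧ M p.2 ∧ p.1 ≫ p.2 = f then (1 : ℚ) else 0) * (autN c)⁻¹ := by
        rw [Finset.sum_comm, mul_apply]
        apply Finset.sum_congr rfl
        intro c _
        rw [mul_diagonal, ← Finset.sum_mul, mul_right_comm, Finset.sum_comm]
        congr 1
        rw [cnt, cnt, Fintype.sum_mul_sum, Fintype.sum_prod_type]
        apply Finset.sum_congr rfl
        intro e _
        apply Finset.sum_congr rfl
        intro m _
        by_cases h1 : E e <;> by_cases h2 : M m <;> simp [h1, h2]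
    _ = _ := by rw [Finset.sum_congr rfl (fun f _ => key f)]; simp

open scoped Classical in
lemma term_eq {A : Type u} [Category.{v} A] [Fintype A]
    [∀ a b : A, Fintype (a ⟶ b)]
    (E M : MorphismProperty A) (hh gg : A → ℕ)
    (hE : ∀ ⦃a b : A⦄ (f : a ⟶ b), E f → a ≠ b → hh a < hh b)
    (hM : ∀ ⦃a b : A⦄ (f : a ⟶ b), M f → a ≠ b → gg a < gg b)
    (a b : A) (n r : ℕ) :
    (∑ p : (Σ o : Fin (n + 1) → A, ∀ i : Fin n, (o i.castSucc ⟶ o i.succ)),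
          if p.1 0 = a ∧ p.1 (Fin.last n) = b ∧
              (∀ i j : Fin (n + 1), i.val ≤ r → j.val ≤ r → p.1 i = p.1 j → i = j) ∧
              (∀ i j : Fin (n + 1), r ≤ i.val → r ≤ j.val → p.1 i = p.1 j → i = j) ∧
              (∀ i : Fin n, i.val < r → M (p.2 i)) ∧
              (∀ i : Fin n, r ≤ i.val → E (p.2 i)) then
            (-1 : ℚ) ^ n / ∏ i : Fin (n + 1), (Nat.card (Aut (p.1 i)) : ℚ)
          else 0) =
    (-1) ^ n * pathMat (fun x : A => (autN x)⁻¹)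
      (fun i => if i < r then cntOff M else cntOff E) n a b := by
  rw [← path_sum, Fintype.sum_sigma, Finset.mul_sum]
  apply Finset.sum_congr rfl
  intro o _
  have equ : ∀ f : (∀ i : Fin n, (o i.castSucc ⟶ o i.succ)),
      ((∀ i j : Fin (n + 1), i.val ≤ r → j.val ≤ r → o i = o j → i = j) ∧
              (∀ i j : Fin (n + 1), r ≤ i.val → r ≤ j.val → o i = o j → i = j) ∧
              (∀ i : Fin n, i.val < r → M (f i)) ∧
              (∀ i : Fin n, r ≤ i.val → E (f i))) ↔
      ∀ i : Fin n, o i.castSucc ≠ o i.succ ∧ (if i.val < r then M (f i) else E (f i)) := by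
    intro f
    constructor
    · rintro ⟨h1, h2, h3, h4⟩ i
      have hne : i.castSucc ≠ i.succ := by
        intro h
        have := congrArg Fin.val h
        simp at this
      by_cases hi : i.val < r
      · rw [if_pos hi]
        exact ⟨fun h => hne (h1 _ _ (by simp; omega) (by simp; omega) h), h3 i hi⟩
      · rw [if_neg hi]
        exact ⟨fun h => hne (h2 _ _ (by simp; omega) (by simp; omega) h), h4 i (by omega)⟩
    · intro H
      have h3 : ∀ i : Fin n, i.val < r → M (f i) := by
        intro i hi
        simpa [hi] using (H i).2
      have h4 : ∀ i : Fin n, r ≤ i.val → E (f i) := by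
        intro i hi
        simpa [Nat.not_lt.2 hi] using (H i).2
      have s1 := fin_strict (fun i => gg (o i)) 0 r (fun i _ hi => hM (f i) (h3 i hi) (H i).1)
      have s2 := fin_strict (fun i => hh (o i)) r n (fun i hi _ => hE (f i) (h4 i hi) (H i).1)
      refine ⟨?_, ?_, h3, h4⟩
      · intro i j hi hj hij
        by_contra hne
        rcases lt_or_gt_of_ne (fun h => hne (Fin.ext h) : i.val ≠ j.val) with h | h
        · have := s1 i j (by omega) hj h
          simp [hij] at this
        · have := s1 j i (by omega) hi h
          simp [hij] at this
      · intro i j hi hj hij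
        by_contra hne
        rcases lt_or_gt_of_ne (fun h => hne (Fin.ext h) : i.val ≠ j.val) with h | h
        · have := s2 i j hi (by omega) h
          simp [hij] at this
        · have := s2 j i hj (by omega) h
          simp [hij] at this
  simp only [equ]
  by_cases hab : o 0 = a ∧ o (Fin.last n) = b
  · simp only [hab.1, hab.2, true_and, and_self, if_true]
    have e1 : (∏ i : Fin n, (if i.val < r then cntOff M else cntOff E)
        (o i.castSucc) (o i.succ)) = ∏ i : Fin n, ∑ f : o i.castSucc ⟶ o i.succ,
          if o i.castSucc ≠ o i.succ ∧ (if i.val < r then M f else E f) then (1 : ℚ) else 0 := by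
      apply Finset.prod_congr rfl
      intro i _
      by_cases hi : i.val < r <;> simp only [hi, if_true, if_false, cntOff]
    rw [e1, Finset.prod_univ_sum, Fintype.piFinset_univ, Finset.mul_sum, Finset.mul_sum]
    apply Finset.sum_congr rfl
    intro f _
    rw [Fintype.prod_boole]
    split_ifs
    · rw [Finset.prod_inv_distrib, mul_one, div_eq_mul_inv]; rfl
    · simp
  · rw [if_neg hab, mul_zero]
    apply Finset.sum_eq_zero
    intro f _
    rw [if_neg]
    rintro ⟨h1, h2, _⟩
    exact hab ⟨h1, h2⟩

end Helpers

open scoped Classical in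
/-- **Theorem 1.6** (Leinster). A finite skeletal category with an epi-mono
factorization system `(E, M)` has Möbius inversion, given by the stated sum
over paths that are an `M`-path of distinct objects followed by an `E`-path of
distinct objects. -/
theorem stmt_3 {A : Type u} [Category.{v} A] [Fintype A]
    [∀ a b : A, Fintype (a ⟶ b)]
    (skel : CategoryTheory.Skeletal A)
    (E M : MorphismProperty A)
    (hE_epi : ∀ ⦃a b : A⦄ (f : a ⟶ b), E f → Epi f)
    (hM_mono : ∀ ⦃a b : A⦄ (f : a ⟶ b), M f → Mono f)
    (hE_id : ∀ a : A, E (𝟙 a)) (hM_id : ∀ a : A, M (𝟙 a))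
    (hE_comp : ∀ ⦃a b c : A⦄ (f : a ⟶ b) (g : b ⟶ c), E f → E g → E (f ≫ g))
    (hM_comp : ∀ ⦃a b c : A⦄ (f : a ⟶ b) (g : b ⟶ c), M f → M g → M (f ≫ g))
    (hfact : ∀ ⦃a b : A⦄ (f : a ⟶ b), ∃ (c : A) (e : a ⟶ c) (m : c ⟶ b),
      E e ∧ M m ∧ e ≫ m = f ∧
        ∀ (c' : A) (e' : a ⟶ c') (m' : c' ⟶ b),
          (E e' ∧ M m' ∧ e' ≫ m' = f) ↔
            ∃ i : c ≅ c', e' = e ≫ i.hom ∧ m' = i.inv ≫ m)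
    (μ : A → A → ℚ)
    (hμ : ∀ a b : A, μ a b =
      ∑' n : ℕ, ∑ r ∈ Finset.range (n + 1),
        ∑ p : (Σ o : Fin (n + 1) → A, ∀ i : Fin n, (o i.castSucc ⟶ o i.succ)),
          if p.1 0 = a ∧ p.1 (Fin.last n) = b ∧
              (∀ i j : Fin (n + 1), i.val ≤ r → j.val ≤ r → p.1 i = p.1 j → i = j) ∧
              (∀ i j : Fin (n + 1), r ≤ i.val → r ≤ j.val → p.1 i = p.1 j → i = j) ∧
              (∀ i : Fin n, i.val < r → M (p.2 i)) ∧
              (∀ i : Fin n, r ≤ i.val → E (p.2 i)) then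
            (-1 : ℚ) ^ n / ∏ i : Fin (n + 1), (Nat.card (Aut (p.1 i)) : ℚ)
          else 0) :
    (∀ a c : A,
      ∑ b : A, μ a b * (Fintype.card (b ⟶ c) : ℚ) = if a = c then 1 else 0) ∧
    (∀ a c : A,
      ∑ b : A, (Fintype.card (a ⟶ b) : ℚ) * μ b c = if a = c then 1 else 0) := by
  have isoEM : ∀ ⦃a : A⦄ (j : a ≅ a), E j.hom ∧ M j.inv := by
    intro a j
    obtain ⟨c, e, m, he, hm, hf, H⟩ := hfact (𝟙 a)
    obtain ⟨i, h1, h2⟩ := (H a (𝟙 a) (𝟙 a)).1 ⟨hE_id a, hM_id a, by simp⟩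
    have h3 := (H a (e ≫ (i ≪≫ j).hom) ((i ≪≫ j).inv ≫ m)).2 ⟨i ≪≫ j, rfl, rfl⟩
    have e1 : e ≫ (i ≪≫ j).hom = j.hom := by
      rw [Iso.trans_hom, ← Category.assoc, ← h1, Category.id_comp]
    have e2 : (i ≪≫ j).inv ≫ m = j.inv := by
      rw [Iso.trans_inv, Category.assoc, ← h2, Category.comp_id]
    rw [e1, e2] at h3
    exact ⟨h3.1, h3.2.1⟩
  have hEiso : ∀ ⦃a : A⦄ (f : a ⟶ a), E f ↔ IsIso f := by
    intro a f
    constructor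
    · intro h
      have := hE_epi f h
      exact epi_endo_iso f
    · intro h
      exact (isoEM (asIso f)).1
  have hMiso : ∀ ⦃a : A⦄ (f : a ⟶ a), M f ↔ IsIso f := by
    intro a f
    constructor
    · intro h
      have := hM_mono f h
      exact mono_endo_iso f
    · intro h
      exact (isoEM (asIso f).symm).2
  obtain ⟨hh, hh1, hh2⟩ := exists_height skel E hE_id hE_comp (fun a f h => (hEiso f).1 h)
  obtain ⟨gg, gg1, gg2⟩ := exists_height skel M hM_id hM_comp (fun a f h => (hMiso f).1 h)
  set L := Fintype.card A + 1 with hL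
  let D' : Matrix A A ℚ := Matrix.diagonal (fun x : A => (autN x)⁻¹)
  let D : Matrix A A ℚ := Matrix.diagonal (fun x : A => autN x)
  have hDD' : D * D' = 1 := by
    simp only [D, D', Matrix.diagonal_mul_diagonal, mul_inv_cancel₀ (autN_ne _), Matrix.diagonal_one]
  have hD'D : D' * D = 1 := by
    simp only [D, D', Matrix.diagonal_mul_diagonal, inv_mul_cancel₀ (autN_ne _), Matrix.diagonal_one]
  let X : Matrix A A ℚ := -(D' * cntOff M)
  let Y : Matrix A A ℚ := -(cntOff E * D')
  have offne : ∀ (W : MorphismProperty A) (a b : A), cntOff W a b ≠ 0 →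
      ∃ f : a ⟶ b, a ≠ b ∧ W f := by
    intro W a b h
    obtain ⟨f, _, hf⟩ := Finset.exists_ne_zero_of_sum_ne_zero h
    by_contra hcon
    exact hf (if_neg fun h => hcon ⟨f, h⟩)
  have hX : ∀ k, L ≤ k → X ^ k = 0 := by
    apply nilp X gg L gg1
    intro a b hab
    simp only [X, D', Matrix.neg_apply, Matrix.diagonal_mul] at hab
    obtain ⟨f, h1, h2⟩ := offne M a b (right_ne_zero_of_mul (neg_ne_zero.1 hab))
    exact gg2 f h2 h1
  have hY : ∀ k, L ≤ k → Y ^ k = 0 := by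
    apply nilp Y hh L hh1
    intro a b hab
    simp only [Y, D', Matrix.neg_apply, Matrix.mul_diagonal] at hab
    obtain ⟨f, h1, h2⟩ := offne E a b (left_ne_zero_of_mul (neg_ne_zero.1 hab))
    exact hh2 f h2 h1
  let Z : Matrix A A ℚ := fun a b => (Fintype.card (a ⟶ b) : ℚ)
  have hZ : Z = (1 - Y) * D * (1 - X) := by
    have h0 : Z = cnt E * D' * cnt M := by
      ext a b
      exact (zeta_fact skel E M hE_epi hfact a b).symm
    have h1 : (1 - Y) * D = cnt E := by
      rw [cnt_split E hEiso]
      change (1 - -(cntOff E * D')) * D = D + cntOff E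
      rw [sub_neg_eq_add, add_mul, one_mul, mul_assoc, hD'D, mul_one]
    have h2 : 1 - X = D' * cnt M := by
      rw [cnt_split M hMiso]
      change 1 - -(D' * cntOff M) = D' * (D + cntOff M)
      rw [sub_neg_eq_add, mul_add, hD'D]
    rw [h1, h2, h0, mul_assoc]
  let SX : Matrix A A ℚ := ∑ n ∈ Finset.range (2 * L), X ^ n
  let SY : Matrix A A ℚ := ∑ n ∈ Finset.range (2 * L), Y ^ n
  have hterm : ∀ a b : A, ∀ n : ℕ, ∀ r ∈ Finset.range (n + 1),
      (-1) ^ n * pathMat (fun x : A => (autN x)⁻¹)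
        (fun i => if i < r then cntOff M else cntOff E) n a b =
      (X ^ r * D' * Y ^ (n - r)) a b := by
    intro a b n r hr
    obtain ⟨s, rfl⟩ := Nat.exists_eq_add_of_le (Nat.lt_succ_iff.1 (Finset.mem_range.1 hr))
    rw [pathMat_split, Nat.add_sub_cancel_left]
    change _ = ((-(D' * cntOff M)) ^ r * D' * (-(cntOff E * D')) ^ s) a b
    rw [← smul_eq_mul, ← Matrix.smul_apply]
    rw [← neg_one_smul ℚ (D' * cntOff M), ← neg_one_smul ℚ (cntOff E * D'), smul_pow, smul_pow,
      smul_mul_assoc, smul_mul_assoc, mul_smul_comm, smul_smul, pow_add]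
  have hμ' : Matrix.of μ = SX * D' * SY := by
    ext a b
    rw [Matrix.of_apply, hμ a b]
    simp only [term_eq E M hh gg hh2 gg2]
    rw [tsum_congr (fun n => Finset.sum_congr rfl (hterm a b n)), tsum_eq_sum (s := Finset.range (2 * L))]
    · rw [← conv_sum X D' Y L hX hY]
      simp only [Matrix.sum_apply]
    · intro n hn
      apply Finset.sum_eq_zero
      intro r _
      rw [Finset.mem_range] at hn
      by_cases h : L ≤ r
      · simp [hX r h]
      · simp [hY (n - r) (by omega)]
  have hSX : SX * (1 - X) = 1 := by
    rw [geom_sum_mul_neg, hX _ (by omega), sub_zero]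
  have hSY : SY * (1 - Y) = 1 := by
    rw [geom_sum_mul_neg, hY _ (by omega), sub_zero]
  have main : Matrix.of μ * Z = 1 := by
    rw [hμ', hZ]
    calc _ = SX * (D' * ((SY * (1 - Y)) * D)) * (1 - X) := by simp only [mul_assoc]
      _ = 1 := by rw [hSY, one_mul, hD'D, mul_one, hSX]
  have main2 : Z * Matrix.of μ = 1 := mul_eq_one_comm.1 main
  constructor
  · intro a c
    have := congrFun (congrFun main a) c
    rw [Matrix.mul_apply, Matrix.one_apply] at this
    exact this
  · intro a c
    have := congrFun (congrFun main2 a) c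
    rw [Matrix.mul_apply, Matrix.one_apply] at this
    exact this
end

section
/- Let A be a finite category in which every idempotent splits (A is Cauchy-complete, i.e. idempotent complete), and let k^• be a weighting on A. Let X : A → Set be a functor with each set Xa finite, and suppose X is nondegenerate, meaning: (i) for all morphisms f : a → b and f' : a' → b of A and elements x ∈ Xa, x' ∈ Xa' with (Xf)(x) = (Xf')(x'), there exist morphisms g : c → a and g' : c → a' and an element z ∈ Xc with f ∘ g = f' ∘ g', (Xg)(z) = x and (Xg')(z) = x'; and (ii) for all parallel morphisms f, f' : a → b and x ∈ Xa with (Xf)(x) = (Xf')(x), there exist g : c → a and z ∈ Xc with f ∘ g = f' ∘ g and (Xg)(z) = x. Then the colimit of X is finite and |colim X| = ∑_a k^a · |Xa|. -/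
open CategoryTheory

/-- Elements with the same image in the colimit are connected by a span. -/
theorem span_of_eq {A : Type u} [Category.{v} A] (X : A ⥤ Type (max u v))
    (hnd₁ : ∀ {a a' b : A} (f : a ⟶ b) (f' : a' ⟶ b) (x : X.obj a) (x' : X.obj a'),
      X.map f x = X.map f' x' →
        ∃ (c : A) (g : c ⟶ a) (g' : c ⟶ a') (z : X.obj c),
          g ≫ f = g' ≫ f' ∧ X.map g z = x ∧ X.map g' z = x')
    {p q : Σ a, X.obj a} (h : Relation.EqvGen X.ColimitTypeRel p q) :
    ∃ (c : A) (g : c ⟶ p.1) (g' : c ⟶ q.1) (z : X.obj c),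
      X.map g z = p.2 ∧ X.map g' z = q.2 := by
  induction h with
  | rel p q h =>
    obtain ⟨f, hf⟩ := h
    exact ⟨p.1, 𝟙 _, f, p.2, by simp, hf.symm⟩
  | refl p => exact ⟨p.1, 𝟙 _, 𝟙 _, p.2, by simp, by simp⟩
  | symm p q _ ih =>
    obtain ⟨c, g, g', z, h1, h2⟩ := ih
    exact ⟨c, g', g, z, h2, h1⟩
  | trans p q r _ _ ih1 ih2 =>
    obtain ⟨c, g, g', z, h1, h2⟩ := ih1
    obtain ⟨d, k, k', w, h3, h4⟩ := ih2
    obtain ⟨e, l, l', t, -, h6, h7⟩ := hnd₁ g' k z w (h2.trans h3.symm)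
    refine ⟨e, l ≫ g, l' ≫ k', t, ?_, ?_⟩
    · rw [Functor.map_comp_apply, h6, h1]
    · rw [Functor.map_comp_apply, h7, h4]

/-- Each element of the colimit has a universal representative. -/
theorem exists_generic {A : Type u} [Category.{v} A] [Finite A]
    [∀ a b : A, Finite (a ⟶ b)]
    [IsIdempotentComplete A]
    (X : A ⥤ Type (max u v)) [∀ a : A, Finite (X.obj a)]
    (hnd₁ : ∀ {a a' b : A} (f : a ⟶ b) (f' : a' ⟶ b) (x : X.obj a) (x' : X.obj a'),
      X.map f x = X.map f' x' →
        ∃ (c : A) (g : c ⟶ a) (g' : c ⟶ a') (z : X.obj c),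
          g ≫ f = g' ≫ f' ∧ X.map g z = x ∧ X.map g' z = x')
    (hnd₂ : ∀ {a b : A} (f f' : a ⟶ b) (x : X.obj a),
      X.map f x = X.map f' x →
        ∃ (c : A) (g : c ⟶ a) (z : X.obj c),
          g ≫ f = g ≫ f' ∧ X.map g z = x)
    (q : Limits.colimit X) :
    ∃ (a : A) (x : X.obj a), Limits.colimit.ι X a x = q ∧
      ∀ (b : A) (y : X.obj b), Limits.colimit.ι X b y = q → ∃! f : a ⟶ b, X.map f x = y := by
  classical
  let P : ObjectProperty X.Elements := fun e => Limits.colimit.ι X e.1 e.2 = q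
  have hP : ∀ {c d : A} (g : c ⟶ d) (z : X.obj c) (y : X.obj d), X.map g z = y →
      Limits.colimit.ι X d y = q → Limits.colimit.ι X c z = q := by
    intro c d g z y h h'
    rw [← h', ← h, Limits.colimit.w_apply]
  have hcof : IsCofiltered P.FullSubcategory :=
    { cone_objs := by
        rintro ⟨⟨a, x⟩, hx⟩ ⟨⟨b, y⟩, hy⟩
        have hx' : Limits.colimit.ι X a x = q := hx
        have hy' : Limits.colimit.ι X b y = q := hy
        obtain ⟨c, g, g', z, h1, h2⟩ := span_of_eq X hnd₁
          (Limits.Types.colimit_eq (hx'.trans hy'.symm))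
        exact ⟨⟨⟨c, z⟩, hP g z x h1 hx'⟩, ObjectProperty.homMk ⟨g, h1⟩,
          ObjectProperty.homMk ⟨g', h2⟩, trivial⟩
      cone_maps := by
        rintro ⟨⟨a, x⟩, hx⟩ ⟨⟨b, y⟩, hy⟩ ⟨⟨f, hf⟩⟩ ⟨⟨f', hf'⟩⟩
        obtain ⟨c, g, z, h1, h2⟩ := hnd₂ f f' x (hf.trans hf'.symm)
        refine ⟨⟨⟨c, z⟩, hP g z x h2 hx⟩, ObjectProperty.homMk ⟨g, h2⟩, ?_⟩
        apply ObjectProperty.hom_ext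
        apply Subtype.ext
        exact h1
      nonempty := by
        obtain ⟨a, x, h⟩ := Limits.Types.jointly_surjective' q
        exact ⟨⟨⟨a, x⟩, h⟩⟩ }
  have : Finite X.Elements := inferInstanceAs (Finite (Σ a, X.obj a))
  have : Finite P.FullSubcategory :=
    Finite.of_injective (fun e => e.obj) (by rintro ⟨e, _⟩ ⟨e', _⟩ h; cases h; rfl)
  have : ∀ e e' : P.FullSubcategory, Finite (e ⟶ e') := fun e e' =>
    Finite.of_injective (β := e.obj.1 ⟶ e'.obj.1) (fun f => f.hom.1) (by
      intro f f' h
      apply ObjectProperty.hom_ext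
      exact Subtype.ext h)
  have := Fintype.ofFinite P.FullSubcategory
  have : ∀ e e' : P.FullSubcategory, Fintype (e ⟶ e') := fun e e' => Fintype.ofFinite _
  obtain ⟨S, T, hT⟩ := IsCofiltered.inf_exists (C := P.FullSubcategory) Finset.univ
    (Set.Finite.toFinset (Set.toFinite Set.univ))
  have hT' : ∀ {e e' : P.FullSubcategory} (f : e ⟶ e'),
      (T (Finset.mem_univ e)) ≫ f = T (Finset.mem_univ e') := by
    intro e e' f
    exact hT _ _ (by simp)
  obtain ⟨⟨s, xs⟩, hs⟩ := S
  have key : ∃ t : ∀ (b : A) (y : X.obj b), Limits.colimit.ι X b y = q → (s ⟶ b),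
      (∀ b y h, X.map (t b y h) xs = y) ∧
      ∀ b y h b' y' h' (f : b ⟶ b'), X.map f y = y' → t b y h ≫ f = t b' y' h' := by
    refine ⟨fun b y h => (T (Finset.mem_univ (⟨⟨b, y⟩, h⟩ : P.FullSubcategory))).hom.1, ?_, ?_⟩
    · intro b y h
      exact (T (Finset.mem_univ (⟨⟨b, y⟩, h⟩ : P.FullSubcategory))).hom.2
    · intro b y h b' y' h' f hf
      exact congrArg (fun m => m.hom.1)
        (hT' (e := ⟨⟨b, y⟩, h⟩) (e' := ⟨⟨b', y'⟩, h'⟩) (ObjectProperty.homMk ⟨f, hf⟩))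
  obtain ⟨t, ht1, ht2⟩ := key
  have hs' : Limits.colimit.ι X s xs = q := hs
  obtain ⟨d, i, r, hir, hri⟩ := IsIdempotentComplete.idempotents_split s (t s xs hs')
    (ht2 _ _ _ _ _ _ _ (ht1 _ _ _))
  have hx : X.map i (X.map r xs) = xs := by
    rw [← Functor.map_comp_apply, hri, ht1]
  refine ⟨d, X.map r xs, hP i _ _ hx hs', ?_⟩
  intro b y h
  refine ⟨i ≫ t b y h, ?_, ?_⟩
  · change X.map (i ≫ t b y h) _ = _
    rw [Functor.map_comp_apply, hx, ht1]
  · intro f hf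
    have h1 := ht2 s xs hs' b y h (r ≫ f) (by rw [Functor.map_comp_apply]; exact hf)
    rw [← h1, ← hri]
    simp only [← Category.assoc, hir, Category.id_comp]

/-- **Theorem 3.3** (Leinster). Let `A` be a finite Cauchy-complete
(idempotent complete) category with a weighting `k`, and let `X : A ⥤ Set` be
a finite nondegenerate functor.  Then the colimit of `X` is finite, of
cardinality `∑_a k^a · |Xa|`. -/
theorem stmt_15 {A : Type u} [Category.{v} A] [Fintype A]
    [∀ a b : A, Fintype (a ⟶ b)]
    [IsIdempotentComplete A]
    (k : A → ℚ) (hk : ∀ a : A, ∑ b : A, (Fintype.card (a ⟶ b) : ℚ) * k b = 1)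
    (X : A ⥤ Type (max u v)) [∀ a : A, Fintype (X.obj a)]
    -- nondegeneracy, condition (i):
    (hnd₁ : ∀ {a a' b : A} (f : a ⟶ b) (f' : a' ⟶ b) (x : X.obj a) (x' : X.obj a'),
      X.map f x = X.map f' x' →
        ∃ (c : A) (g : c ⟶ a) (g' : c ⟶ a') (z : X.obj c),
          g ≫ f = g' ≫ f' ∧ X.map g z = x ∧ X.map g' z = x')
    -- nondegeneracy, condition (ii):
    (hnd₂ : ∀ {a b : A} (f f' : a ⟶ b) (x : X.obj a),
      X.map f x = X.map f' x →
        ∃ (c : A) (g : c ⟶ a) (z : X.obj c),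
          g ≫ f = g ≫ f' ∧ X.map g z = x) :
    Finite (Limits.colimit X) ∧
      (Nat.card (Limits.colimit X) : ℚ) =
        ∑ a : A, k a * (Fintype.card (X.obj a) : ℚ) := by
  classical
  have hfin : Finite (Limits.colimit X) := by
    refine Finite.of_surjective (α := Σ a, X.obj a)
      (fun p => Limits.colimit.ι X p.1 p.2) ?_
    intro q
    obtain ⟨a, x, h⟩ := Limits.Types.jointly_surjective' q
    exact ⟨⟨a, x⟩, h⟩
  refine ⟨hfin, ?_⟩
  have := Fintype.ofFinite (Limits.colimit X)
  choose g x hx hu using exists_generic X hnd₁ hnd₂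
  have hcard : ∀ b : A, Fintype.card (X.obj b) =
      ∑ q : Limits.colimit X, Fintype.card (g q ⟶ b) := by
    intro b
    rw [← Fintype.card_sigma]
    symm
    refine Fintype.card_of_bijective (f := fun p : (Σ q, (g q ⟶ b)) => X.map p.2 (x p.1)) ⟨?_, ?_⟩
    · have hι : ∀ (q) (f : g q ⟶ b), Limits.colimit.ι X b (X.map f (x q)) = q := by
        intro q f
        rw [Limits.colimit.w_apply, hx]
      rintro ⟨q, f⟩ ⟨q', f'⟩ h
      dsimp only at h
      have hq : q = q' := by rw [← hι q f, h, hι]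
      subst hq
      rw [(hu q b _ (hι q f')).unique h rfl]
    · intro y
      obtain ⟨f, hf, -⟩ := hu _ b y rfl
      exact ⟨⟨_, f⟩, hf⟩
  simp only [hcard, Nat.cast_sum, Finset.mul_sum]
  rw [Finset.sum_comm, Nat.card_eq_fintype_card]
  have : ∀ q : Limits.colimit X, ∑ b : A, k b * (Fintype.card (g q ⟶ b) : ℚ) = 1 := by
    intro q
    rw [← hk (g q)]
    exact Finset.sum_congr rfl fun b _ => mul_comm _ _
  simp [this]
end

section
/- Let A be a finite category with Möbius inversion with Möbius function μ_A, and let Ã be the category obtained from A by freely adjoining an initial object 0 and a terminal object 1 (so Ã has exactly one morphism 0 → x for every object x, exactly one morphism x → 1 for every object x, and the morphisms between objects of A are those of A). Then Ã has Möbius inversion, and μ_Ã(0, 1) = χ(A) − 1 = (∑_{a,b} μ_A(a,b)) − 1, where the sum is over all pairs of objects a, b of A. -/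
open CategoryTheory

/-- Objects of the extended category as a twice-extended option type. -/
def extEquiv (A : Type*) : Option (Option A) ≃ WithTerminal (WithInitial A) where
  toFun x := match x with
    | none => WithTerminal.star
    | some none => WithTerminal.of WithInitial.star
    | some (some a) => WithTerminal.of (WithInitial.of a)
  invFun x := match x with
    | WithTerminal.star => none
    | WithTerminal.of WithInitial.star => some none
    | WithTerminal.of (WithInitial.of a) => some (some a)
  left_inv x := by rcases x with _ | _ | a <;> rfl
  right_inv x := by rcases x with (a | _) | _ <;> rfl

theorem ext_finsum {A : Type*} [Fintype A] (f : WithTerminal (WithInitial A) → ℚ) :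
    ∑ᶠ y, f y = f WithTerminal.star + (f (WithTerminal.of WithInitial.star) +
      ∑ a : A, f (WithTerminal.of (WithInitial.of a))) := by
  rw [← finsum_comp_equiv (extEquiv A), finsum_eq_sum_of_fintype,
    Fintype.sum_option, Fintype.sum_option]
  rfl

/-- The Möbius function of the extended category. -/
def extMu {A : Type*} [Fintype A] (m : A → A → ℚ) :
    WithTerminal (WithInitial A) → WithTerminal (WithInitial A) → ℚ
  | WithTerminal.star, WithTerminal.star => 1
  | WithTerminal.star, WithTerminal.of _ => 0
  | WithTerminal.of WithInitial.star, WithTerminal.star => (∑ a : A, ∑ b : A, m a b) - 1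
  | WithTerminal.of WithInitial.star, WithTerminal.of WithInitial.star => 1
  | WithTerminal.of WithInitial.star, WithTerminal.of (WithInitial.of b) => - ∑ a : A, m a b
  | WithTerminal.of (WithInitial.of a), WithTerminal.star => - ∑ b : A, m a b
  | WithTerminal.of (WithInitial.of _), WithTerminal.of WithInitial.star => 0
  | WithTerminal.of (WithInitial.of a), WithTerminal.of (WithInitial.of b) => m a b

universe w
section cards
variable {A : Type*} [Category.{w} A]

theorem card_to_star (x : WithTerminal (WithInitial A)) :
    Nat.card (x ⟶ WithTerminal.star) = 1 := by
  rcases x with x | _ <;> exact Nat.card_unique (α := PUnit.{w+1})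

theorem card_from_star (x : WithInitial A) :
    Nat.card ((WithTerminal.star : WithTerminal (WithInitial A)) ⟶ WithTerminal.of x) = 0 :=
  Nat.card_of_isEmpty (α := PEmpty.{w+1})

theorem card_from_init (x : WithInitial A) :
    Nat.card ((WithTerminal.of WithInitial.star : WithTerminal (WithInitial A)) ⟶
      WithTerminal.of x) = 1 := by
  rcases x with x | _ <;> exact Nat.card_unique (α := PUnit.{w+1})

theorem card_to_init (a : A) :
    Nat.card ((WithTerminal.of (WithInitial.of a) : WithTerminal (WithInitial A)) ⟶
      WithTerminal.of WithInitial.star) = 0 :=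
  Nat.card_of_isEmpty (α := PEmpty.{w+1})

theorem card_of_of (a b : A) [Fintype (a ⟶ b)] :
    Nat.card ((WithTerminal.of (WithInitial.of a) : WithTerminal (WithInitial A)) ⟶
      WithTerminal.of (WithInitial.of b)) = Fintype.card (a ⟶ b) :=
  Nat.card_eq_fintype_card (α := (a ⟶ b))

end cards

open scoped Classical in
/-- **Proposition 4.5** (Leinster). If a finite category `A` has Möbius
inversion `μ_A`, then the category `Ã = WithTerminal (WithInitial A)`,
obtained from `A` by freely adjoining an initial object `0` and a terminal
object `1`, also has Möbius inversion, and
`μ_Ã(0,1) = χ(A) - 1 = (∑_{a,b} μ_A(a,b)) - 1`.  (Sums over the objects of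
`Ã` are written as `finsum`s, and hom-set cardinalities via `Nat.card`.) -/
theorem stmt_19 {A : Type u} [Category.{v} A] [Fintype A]
    [∀ a b : A, Fintype (a ⟶ b)]
    (μA : A → A → ℚ)
    (hμA₁ : ∀ a c : A,
      ∑ b : A, μA a b * (Fintype.card (b ⟶ c) : ℚ) = if a = c then 1 else 0)
    (hμA₂ : ∀ a c : A,
      ∑ b : A, (Fintype.card (a ⟶ b) : ℚ) * μA b c = if a = c then 1 else 0) :
    ∃ μ : WithTerminal (WithInitial A) → WithTerminal (WithInitial A) → ℚ,
      (∀ x z : WithTerminal (WithInitial A),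
        ∑ᶠ y : WithTerminal (WithInitial A),
          μ x y * (Nat.card (y ⟶ z) : ℚ) = if x = z then 1 else 0) ∧
      (∀ x z : WithTerminal (WithInitial A),
        ∑ᶠ y : WithTerminal (WithInitial A),
          (Nat.card (x ⟶ y) : ℚ) * μ y z = if x = z then 1 else 0) ∧
      μ (WithTerminal.of WithInitial.star) WithTerminal.star =
        (∑ a : A, ∑ b : A, μA a b) - 1 := by
  have h1 : ∀ c : A, ∑ b : A, (∑ a : A, μA a b) * (Fintype.card (b ⟶ c) : ℚ) = 1 := by
    intro c
    simp only [Finset.sum_mul]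
    rw [Finset.sum_comm]
    simp [hμA₁]
  have h2 : ∀ a : A, ∑ b : A, (Fintype.card (a ⟶ b) : ℚ) * (∑ c : A, μA b c) = 1 := by
    intro c
    simp only [Finset.mul_sum]
    rw [Finset.sum_comm]
    simp [hμA₂]
  have h3 : ∑ b : A, ∑ a : A, μA a b = ∑ a : A, ∑ b : A, μA a b := Finset.sum_comm
  refine ⟨extMu μA, ?_, ?_, rfl⟩
  · intro x z
    rw [ext_finsum]
    rcases x with (a | _) | _ <;> rcases z with (c | _) | _ <;>
      simp [extMu, card_from_star, card_from_init, card_to_init, card_of_of,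
        hμA₁, h1, h3]
    ring
  · intro x z
    rw [ext_finsum]
    rcases x with (a | _) | _ <;> rcases z with (c | _) | _ <;>
      simp [extMu, card_from_star, card_from_init, card_to_init, card_of_of,
        hμA₂, h2]
    ring
end
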